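/- Let D be a complex-linear map on the algebra of n×n complex matrices that maps Hermitian matrices to Hermitian matrices and is a derivation of both products of observables: D([A,B]₋) = [D(A),B]₋ + [A,D(B)]₋ and D(A∘B) = D(A)∘B + A∘D(B) for all n×n complex matrices A, B. Then there exists a Hermitian n×n matrix H such that D(A) = −i(HA − AH) for every matrix A; i.e., the linear differential equations preserving both products are exactly those generated by infinitesimal unitary transformations. -/

import Mathlib

open Matrix

/-- The Lie product of observables: `[A,B]₋ = -i (AB - BA)`. -/
noncomputable def lieBr {n : ℕ} (A B : Matrix (Fin n) (Fin n) ℂ) : Matrix (Fin n) (Fin n) ℂ :=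
  (-Complex.I) • (A * B - B * A)

/-- The Jordan product of observables: `A ∘ B = (1/2)(AB + BA)`. -/
noncomputable def jordanPr {n : ℕ} (A B : Matrix (Fin n) (Fin n) ℂ) : Matrix (Fin n) (Fin n) ℂ :=
  (1 / 2 : ℂ) • (A * B + B * A)

/-- Every derivation of a full matrix algebra over a commutative ring is inner. -/
theorem exists_eq_commutator_of_map_mul {m R : Type*} [Fintype m] [DecidableEq m] [CommRing R]
    (D : Matrix m m R →ₗ[R] Matrix m m R) (hD : ∀ A B, D (A * B) = D A * B + A * D B) :
    ∃ K : Matrix m m R, ∀ A, D A = K * A - A * K := by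
  rcases isEmpty_or_nonempty m with _ | ⟨⟨z⟩⟩
  · exact ⟨0, fun A => Subsingleton.elim _ _⟩
  have hsum : ∑ i : m, single i z (1 : R) * single z i 1 = 1 := by
    simp [sum_single_one]
  have hcol (A : Matrix m m R) (j : m) :
      A * single j z (1 : R) = ∑ i, A i j • single i z (1 : R) := by
    ext a b
    simp [Matrix.sum_apply, Matrix.mul_apply, single_apply, ite_and]
  have hrow (A : Matrix m m R) (i : m) :
      single z i (1 : R) * A = ∑ j, A i j • single z j (1 : R) := by
    ext a b
    simp [Matrix.sum_apply, Matrix.mul_apply, single_apply, ite_and]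
  refine ⟨∑ i, D (single i z 1) * single z i 1, fun A => ?_⟩
  rw [eq_sub_iff_add_eq]
  calc D A + A * ∑ i, D (single i z 1) * single z i 1
      = D A * ∑ i, single i z (1 : R) * single z i 1
          + A * ∑ i, D (single i z 1) * single z i 1 := by rw [hsum, mul_one]
    _ = ∑ j, D (A * single j z 1) * single z j 1 := by
        simp only [hD, add_mul, Finset.sum_add_distrib, Finset.mul_sum, mul_assoc]
    _ = (∑ i, D (single i z 1) * single z i 1) * A := by
        simp only [hcol, map_sum, map_smul, Finset.sum_mul, mul_assoc, hrow, Finset.mul_sum,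
          smul_mul_assoc, mul_smul_comm]
        exact Finset.sum_comm

/-- A linear map preserving Hermiticity commutes with the conjugate transpose. -/
theorem map_conjTranspose_of_map_isHermitian {m : Type*}
    (D : Matrix m m ℂ →ₗ[ℂ] Matrix m m ℂ)
    (hD : ∀ A : Matrix m m ℂ, A.IsHermitian → (D A).IsHermitian) (A : Matrix m m ℂ) :
    D Aᴴ = (D A)ᴴ := by
  have h1 : (D A)ᴴ + (D Aᴴ)ᴴ = D A + D Aᴴ := by
    have h := hD (A + Aᴴ) (isHermitian_add_transpose_self A)
    rwa [Matrix.IsHermitian, map_add, conjTranspose_add] at h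
  have h2 : (D A)ᴴ - (D Aᴴ)ᴴ = D Aᴴ - D A := by
    have h := hD (Complex.I • (A - Aᴴ)) (by
      rw [Matrix.IsHermitian, conjTranspose_smul, conjTranspose_sub, conjTranspose_conjTranspose,
        Complex.star_def, Complex.conj_I]
      module)
    rw [Matrix.IsHermitian, map_smul, map_sub, conjTranspose_smul, conjTranspose_sub,
      Complex.star_def, Complex.conj_I, neg_smul, ← smul_neg, neg_sub] at h
    rw [← neg_sub (D A), ← smul_right_injective _ Complex.I_ne_zero h, neg_sub]
  linear_combination (norm := module) (-1 / 2 : ℂ) • h1 - (1 / 2 : ℂ) • h2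

/-- A simultaneous derivation of the Lie and Jordan products is a derivation of the associative
product. -/
theorem map_mul_of_lieBr_of_jordanPr {n : ℕ}
    (D : Matrix (Fin n) (Fin n) ℂ →ₗ[ℂ] Matrix (Fin n) (Fin n) ℂ)
    (hlie : ∀ A B, D (lieBr A B) = lieBr (D A) B + lieBr A (D B))
    (hjor : ∀ A B, D (jordanPr A B) = jordanPr (D A) B + jordanPr A (D B))
    (A B : Matrix (Fin n) (Fin n) ℂ) : D (A * B) = D A * B + A * D B := by
  have key (X Y : Matrix (Fin n) (Fin n) ℂ) :
      X * Y = jordanPr X Y + (Complex.I / 2) • lieBr X Y := by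
    have hI : Complex.I / 2 * -Complex.I = 1 / 2 := by
      linear_combination (-1 / 2 : ℂ) * Complex.I_mul_I
    rw [jordanPr, lieBr, smul_smul, hI]
    module
  rw [key A B, key (D A) B, key A (D B), map_add, map_smul, hlie, hjor]
  module

/-- A linear map preserving Hermiticity that is a derivation of both the Lie and the Jordan
products of observables is an infinitesimal unitary transformation: `D(A) = -i(HA - AH)` for
some Hermitian `H`. -/
theorem derivation_is_unitary_generator {n : ℕ}
    (D : Matrix (Fin n) (Fin n) ℂ →ₗ[ℂ] Matrix (Fin n) (Fin n) ℂ)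
    (hherm : ∀ A : Matrix (Fin n) (Fin n) ℂ, A.IsHermitian → (D A).IsHermitian)
    (hlie : ∀ A B : Matrix (Fin n) (Fin n) ℂ,
      D (lieBr A B) = lieBr (D A) B + lieBr A (D B))
    (hjor : ∀ A B : Matrix (Fin n) (Fin n) ℂ,
      D (jordanPr A B) = jordanPr (D A) B + jordanPr A (D B)) :
    ∃ H : Matrix (Fin n) (Fin n) ℂ, H.IsHermitian ∧
      ∀ A : Matrix (Fin n) (Fin n) ℂ, D A = (-Complex.I) • (H * A - A * H) := by
  have hmul : ∀ A B, D (A * B) = D A * B + A * D B := map_mul_of_lieBr_of_jordanPr D hlie hjor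
  obtain ⟨K, hK⟩ := exists_eq_commutator_of_map_mul D hmul
  refine ⟨(Complex.I / 2) • (K - Kᴴ), ?_, fun A => ?_⟩
  · have hI : star (Complex.I / 2) = -(Complex.I / 2) := by simp [neg_div]
    rw [Matrix.IsHermitian, conjTranspose_smul, hI, conjTranspose_sub, conjTranspose_conjTranspose]
    module
  · have hA : D A = A * Kᴴ - Kᴴ * A := by
      have h := map_conjTranspose_of_map_isHermitian D hherm Aᴴ
      rw [conjTranspose_conjTranspose, hK Aᴴ] at h
      simpa using h
    have hI : -Complex.I * (Complex.I / 2) = 1 / 2 := by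
      linear_combination (-1 / 2 : ℂ) * Complex.I_mul_I
    rw [smul_mul_assoc, mul_smul_comm, ← smul_sub, smul_smul, hI]
    have h2 : (K - Kᴴ) * A - A * (K - Kᴴ) = D A + D A := by
      nth_rewrite 1 [hK A]
      rw [hA]
      noncomm_ring
    rw [h2]
    module
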